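/- Let μ ≥ 0 and let h : ℝ → ℝ be twice continuously differentiable. Let w : ℝ → ℝ be smooth and compactly supported, and define (𝒯w)(x) = h(x)·w(x) − (μ/3)·d/dx( h(x)³·w′(x) ). Then ∫_ℝ [ (𝒯w)′(x) − (𝒯(w′))(x) ] · w(x) dx = ∫_ℝ h′(x) · w(x)² dx + (μ/3) ∫_ℝ (h³)′(x) · w′(x)² dx. -/

import Mathlib

open MeasureTheory

/-- The operator `𝒯` from the symmetrization of the Boussinesq–Peregrine system:
`(𝒯w)(x) = h(x)·w(x) − (μ/3)·d/dx( h(x)³·w′(x) )`. -/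
noncomputable def Tcal (μ : ℝ) (h w : ℝ → ℝ) (x : ℝ) : ℝ :=
  h x * w x - μ / 3 * deriv (fun y => (h y)^3 * deriv w y) x

/-- The commutator `[∂_x, 𝒯]w` equals `h′w − (μ/3)·d/dx( (h³)′·w′ )`. -/
theorem deriv_Tcal_sub_Tcal_deriv (μ : ℝ) {h w : ℝ → ℝ} (hh : ContDiff ℝ 2 h)
    (hw : ContDiff ℝ 3 w) (x : ℝ) :
    deriv (Tcal μ h w) x - Tcal μ h (deriv w) x
      = deriv h x * w x - μ / 3 * deriv (fun y => deriv (fun z => (h z) ^ 3) y * deriv w y) x := by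
  have hH : ContDiff ℝ 2 (fun y => (h y) ^ 3) := hh.pow 3
  have hH' : ContDiff ℝ 1 (deriv fun y => (h y) ^ 3) := ContDiff.deriv' (n := 1) hH
  have hw' : ContDiff ℝ 2 (deriv w) := ContDiff.deriv' (n := 2) hw
  have hw'' : ContDiff ℝ 1 (deriv (deriv w)) := ContDiff.deriv' (n := 1) hw'
  have dh : Differentiable ℝ h := hh.differentiable (by norm_num)
  have dw : Differentiable ℝ w := hw.differentiable (by norm_num)
  have dH : Differentiable ℝ (fun y => (h y) ^ 3) := hH.differentiable (by norm_num)
  have dw' : Differentiable ℝ (deriv w) := hw'.differentiable (by norm_num)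
  have dP : Differentiable ℝ (fun y => deriv (fun z => (h z) ^ 3) y * deriv w y) :=
    (hH'.differentiable (by norm_num)).mul dw'
  have dQ : Differentiable ℝ (fun y => (h y) ^ 3 * deriv (deriv w) y) :=
    dH.mul (hw''.differentiable (by norm_num))
  have hT : Tcal μ h w = fun y => h y * w y - μ / 3 *
      (deriv (fun z => (h z) ^ 3) y * deriv w y + (h y) ^ 3 * deriv (deriv w) y) := by
    funext y
    rw [Tcal, ((dH y).hasDerivAt.fun_mul (dw' y).hasDerivAt).deriv]
  have hT' := ((dh x).hasDerivAt.fun_mul (dw x).hasDerivAt).fun_sub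
    (((dP x).hasDerivAt.fun_add (dQ x).hasDerivAt).const_mul (μ / 3))
  rw [hT, hT'.deriv, Tcal]
  ring

/-- Integration by parts for a `C¹` function `g` and a compactly supported `C²` function `w`. -/
theorem integral_deriv_mul_deriv_mul_self {g w : ℝ → ℝ} (hg : ContDiff ℝ 1 g)
    (hw : ContDiff ℝ 2 w) (hw_supp : HasCompactSupport w) :
    ∫ x, deriv (fun y => g y * deriv w y) x * w x = -∫ x, g x * (deriv w x) ^ 2 := by
  have hw' : ContDiff ℝ 1 (deriv w) := ContDiff.deriv' (n := 1) hw
  have hgw : ContDiff ℝ 1 (fun y => g y * deriv w y) := hg.mul hw'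
  have cw := hw.continuous
  have dgw := hgw.differentiable (by norm_num)
  have dw := hw.differentiable (by norm_num)
  have key := integral_mul_deriv_eq_deriv_mul_of_integrable
    (u := fun y => g y * deriv w y) (v := w)
    (fun x _ => (dgw x).hasDerivAt) (fun x _ => (dw x).hasDerivAt)
    ((hgw.continuous.mul hw'.continuous).integrable_of_hasCompactSupport hw_supp.deriv.mul_left)
    (((hgw.continuous_deriv le_rfl).mul cw).integrable_of_hasCompactSupport hw_supp.mul_left)
    ((hgw.continuous.mul cw).integrable_of_hasCompactSupport hw_supp.mul_left)
  simp only [sq, ← mul_assoc]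
  rw [key, neg_neg]

/-- Quadratic-form identity for the spatial commutator `([∂_x, 𝒯]w, w)_{L²}`. -/
theorem Tcal_space_commutator_identity
    (μ : ℝ) (hμ : 0 ≤ μ) (h : ℝ → ℝ) (hh : ContDiff ℝ 2 h)
    (w : ℝ → ℝ) (hw : ContDiff ℝ (⊤ : ℕ∞) w) (hw_supp : HasCompactSupport w) :
    ∫ x : ℝ, (deriv (Tcal μ h w) x - Tcal μ h (deriv w) x) * w x
      = (∫ x : ℝ, deriv h x * (w x)^2)
        + μ / 3 * ∫ x : ℝ, deriv (fun y => (h y)^3) x * (deriv w x)^2 := by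
  have hw3 : ContDiff ℝ 3 w := contDiff_infty.1 hw 3
  have hw2 : ContDiff ℝ 2 w := contDiff_infty.1 hw 2
  have hH' : ContDiff ℝ 1 (deriv fun y => (h y) ^ 3) := ContDiff.deriv' (n := 1) (hh.pow 3)
  have hw' : ContDiff ℝ 1 (deriv w) := ContDiff.deriv' (n := 1) hw2
  have i₁ : Integrable fun x => deriv h x * (w x) ^ 2 := by
    simp only [sq]
    exact ((hh.continuous_deriv (by norm_num)).mul
      (hw.continuous.mul hw.continuous)).integrable_of_hasCompactSupport hw_supp.mul_left.mul_left
  have i₂ : Integrable fun x => deriv (fun y => deriv (fun z => (h z) ^ 3) y * deriv w y) x * w x :=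
    (((hH'.mul hw').continuous_deriv le_rfl).mul hw.continuous).integrable_of_hasCompactSupport
      hw_supp.mul_left
  have hpt : ∀ x, (deriv (Tcal μ h w) x - Tcal μ h (deriv w) x) * w x = deriv h x * (w x) ^ 2
      - μ / 3 * (deriv (fun y => deriv (fun z => (h z) ^ 3) y * deriv w y) x * w x) := fun x => by
    rw [deriv_Tcal_sub_Tcal_deriv μ hh hw3]
    ring
  simp only [hpt]
  rw [integral_sub i₁ (i₂.const_mul _), integral_const_mul,
    integral_deriv_mul_deriv_mul_self hH' hw2 hw_supp]
  ring
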